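/- Let n ≥ 2 and ε > 0. Every ε-optimal vector strategy {u_r},{v_j} for the game CHSH(n) satisfies dim span{v_1,…,v_n} ≥ n − 8√2 · n(n−1) · ε. -/

import Mathlib

open scoped BigOperators RealInnerProductSpace
open Matrix Kronecker

noncomputable section

/-- An XOR game is given by a cost matrix whose absolute entries sum to 1. -/
def isXORGame {ι κ : Type*} [Fintype ι] [Fintype κ] (G : Matrix ι κ ℝ) : Prop :=
  ∑ i, ∑ j, |G i j| = 1

/-- The bias of a vector strategy. -/
def stratBias {ι κ : Type*} [Fintype ι] [Fintype κ] (G : Matrix ι κ ℝ) {N : ℕ}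
    (u : ι → EuclideanSpace ℝ (Fin N)) (v : κ → EuclideanSpace ℝ (Fin N)) : ℝ :=
  ∑ i, ∑ j, G i j * ⟪u i, v j⟫

/-- The quantum bias of an XOR game: supremum of biases of vector strategies. -/
def quantumBias {ι κ : Type*} [Fintype ι] [Fintype κ] (G : Matrix ι κ ℝ) : ℝ :=
  sSup {b : ℝ | ∃ (N : ℕ) (u : ι → EuclideanSpace ℝ (Fin N))
      (v : κ → EuclideanSpace ℝ (Fin N)),
    (∀ i, ‖u i‖ = 1) ∧ (∀ j, ‖v j‖ = 1) ∧ stratBias G u v = b}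

/-- Objective function of the optimization problem (Γ). -/
def gammaObj {ι κ : Type*} [Fintype ι] [Fintype κ] (G : Matrix ι κ ℝ)
    (V : Matrix κ κ ℝ) : ℝ :=
  ∑ i, Real.sqrt (∑ j, ∑ k, G i j * G i k * V j k)

/-- `V` is an optimal solution of (Γ). -/
def gammaOptimal {ι κ : Type*} [Fintype ι] [Fintype κ] (G : Matrix ι κ ℝ)
    (V : Matrix κ κ ℝ) : Prop :=
  V.PosSemidef ∧ (∀ j, V j j = 1) ∧
    ∀ W : Matrix κ κ ℝ, W.PosSemidef → (∀ j, W j j = 1) → gammaObj G W ≤ gammaObj G V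

/-- `c` is the family of marginal row biases of `G`. -/
def isMarginalRowBiases {ι κ : Type*} [Fintype ι] [Fintype κ] (G : Matrix ι κ ℝ)
    (c : ι → ℝ) : Prop :=
  (∀ i, 0 ≤ c i) ∧
  ∀ (N : ℕ) (u : ι → EuclideanSpace ℝ (Fin N)) (v : κ → EuclideanSpace ℝ (Fin N)),
    (∀ i, ‖u i‖ = 1) → (∀ j, ‖v j‖ = 1) → stratBias G u v = quantumBias G →
    ∀ i, ∑ j, G i j * ⟪u i, v j⟫ = c i

/-- `d` is the family of marginal column biases of `G`. -/
def isMarginalColBiases {ι κ : Type*} [Fintype ι] [Fintype κ] (G : Matrix ι κ ℝ)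
    (d : κ → ℝ) : Prop :=
  (∀ j, 0 ≤ d j) ∧
  ∀ (N : ℕ) (u : ι → EuclideanSpace ℝ (Fin N)) (v : κ → EuclideanSpace ℝ (Fin N)),
    (∀ i, ‖u i‖ = 1) → (∀ j, ‖v j‖ = 1) → stratBias G u v = quantumBias G →
    ∀ j, ∑ i, G i j * ⟪u i, v j⟫ = d j

/-- Hermitian inner product on `ι → ℂ`. -/
def cinner {ι : Type*} [Fintype ι] (x y : ι → ℂ) : ℂ := ∑ i, star (x i) * y i

/-- Hilbert space norm on `ι → ℂ`. -/
def cnorm {ι : Type*} [Fintype ι] (x : ι → ℂ) : ℝ := Real.sqrt (∑ i, ‖x i‖ ^ 2)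

/-- Frobenius norm of a complex matrix. -/
def frobNorm {ι κ : Type*} [Fintype ι] [Fintype κ] (M : Matrix ι κ ℂ) : ℝ :=
  Real.sqrt (∑ i, ∑ j, ‖M i j‖ ^ 2)

/-- Operator norm of a complex square matrix. -/
def opNorm {ι : Type*} [Fintype ι] [DecidableEq ι] (M : Matrix ι ι ℂ) : ℝ :=
  ‖Matrix.toEuclideanCLM (𝕜 := ℂ) M‖

/-- Bias of a quantum strategy. -/
def qStratBias {ι κ : Type*} [Fintype ι] [Fintype κ] {d₁ d₂ : ℕ} (G : Matrix ι κ ℝ)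
    (A : ι → Matrix (Fin d₁) (Fin d₁) ℂ) (B : κ → Matrix (Fin d₂) (Fin d₂) ℂ)
    (ψ : Fin d₁ × Fin d₂ → ℂ) : ℂ :=
  ∑ i, ∑ j, (G i j : ℂ) * cinner ψ ((A i ⊗ₖ B j).mulVec ψ)

/-- Nondegeneracy of a quantum strategy. -/
def Nondegenerate {ι κ : Type*} {d₁ d₂ : ℕ}
    (A : ι → Matrix (Fin d₁) (Fin d₁) ℂ) (B : κ → Matrix (Fin d₂) (Fin d₂) ℂ)
    (ψ : Fin d₁ × Fin d₂ → ℂ) : Prop :=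
  (¬ ∃ P : Matrix (Fin d₁) (Fin d₁) ℂ, P ≠ 1 ∧ P.IsHermitian ∧ P * P = P ∧
      (∀ i, P * A i = A i * P) ∧ (P ⊗ₖ (1 : Matrix (Fin d₂) (Fin d₂) ℂ)).mulVec ψ = ψ) ∧
  (¬ ∃ Q : Matrix (Fin d₂) (Fin d₂) ℂ, Q ≠ 1 ∧ Q.IsHermitian ∧ Q * Q = Q ∧
      (∀ j, Q * B j = B j * Q) ∧ ((1 : Matrix (Fin d₁) (Fin d₁) ℂ) ⊗ₖ Q).mulVec ψ = ψ)

/-- Row index type for the XOR game associated to a graph `H`: one ordered edge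
`(i,j)` with `i < j` together with a boolean choosing one of the two rows. -/
def GraphRow {v : ℕ} (H : SimpleGraph (Fin v)) [DecidableRel H.Adj] : Type :=
  {p : Fin v × Fin v // p.1 < p.2 ∧ H.Adj p.1 p.2} × Bool

instance {v : ℕ} (H : SimpleGraph (Fin v)) [DecidableRel H.Adj] :
    Fintype (GraphRow H) := by
  unfold GraphRow; infer_instance

/-- The XOR game `A_H` associated to a graph `H` with `e` edges: for each edge
`{i,j}` (`i < j`), one row with entries `1/(4e)` at `i` and `−1/(4e)` at `j`, and
one row with entries `1/(4e)` at both `i` and `j`. -/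
def graphGame {v : ℕ} (H : SimpleGraph (Fin v)) [DecidableRel H.Adj] (e : ℕ) :
    Matrix (GraphRow H) (Fin v) ℝ :=
  fun r k =>
    if k = r.1.1.1 then 1 / (4 * e)
    else if k = r.1.1.2 then (if r.2 then 1 / (4 * e) else -(1 / (4 * e)))
    else 0


/-- The game `CHSH(n)`: the graph game of the complete graph `K_n`
(which has `n(n−1)/2` edges). -/
def CHSHgame (n : ℕ) :
    Matrix (GraphRow (⊤ : SimpleGraph (Fin n))) (Fin n) ℝ :=
  graphGame (⊤ : SimpleGraph (Fin n)) (n * (n - 1) / 2)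

/-- Rows of a graph game come in pairs indexed by the ordered edges. -/
lemma sum_graphRow {n : ℕ} (H : SimpleGraph (Fin n)) [DecidableRel H.Adj]
    (f : GraphRow H → ℝ) :
    ∑ r, f r = ∑ p : {p : Fin n × Fin n // p.1 < p.2 ∧ H.Adj p.1 p.2},
      (f (p, true) + f (p, false)) := by
  have h : ∑ r, f r =
      ∑ p : {p : Fin n × Fin n // p.1 < p.2 ∧ H.Adj p.1 p.2}, ∑ c, f (p, c) :=
    (Fintype.sum_equiv (Equiv.refl _) f
      (fun q : {p : Fin n × Fin n // p.1 < p.2 ∧ H.Adj p.1 p.2} × Bool => f (q.1, q.2))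
      fun _ => rfl).trans (Fintype.sum_prod_type _)
  simp_rw [h, Fintype.sum_bool]

lemma graphGame_row_sum {n : ℕ} (H : SimpleGraph (Fin n)) [DecidableRel H.Adj] (e : ℕ)
    (r : GraphRow H) (g : Fin n → ℝ) :
    ∑ k, graphGame H e r k * g k =
      1 / (4 * e) * (g r.1.1.1 + (if r.2 then 1 else -1) * g r.1.1.2) := by
  have hne : r.1.1.2 ≠ r.1.1.1 := r.1.2.1.ne'
  have h : ∀ k, graphGame H e r k * g k =
      (if k = r.1.1.1 then 1 / (4 * e) * g k else 0) +
      (if k = r.1.1.2 then 1 / (4 * e) * ((if r.2 then 1 else -1) * g k) else 0) := by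
    intro k
    unfold graphGame
    by_cases h1 : k = r.1.1.1
    · have h2 : k ≠ r.1.1.2 := fun h => hne (h.symm.trans h1)
      rw [if_pos h1, if_pos h1, if_neg h2, add_zero]
    · rw [if_neg h1, if_neg h1]
      split_ifs <;> ring
  simp_rw [h]
  rw [Finset.sum_add_distrib, Finset.sum_ite_eq', Finset.sum_ite_eq']
  simp only [Finset.mem_univ, if_true]
  ring

lemma stratBias_graphGame {n : ℕ} (H : SimpleGraph (Fin n)) [DecidableRel H.Adj] (e : ℕ)
    {N : ℕ} (u : GraphRow H → EuclideanSpace ℝ (Fin N)) (v : Fin n → EuclideanSpace ℝ (Fin N)) :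
    stratBias (graphGame H e) u v =
      ∑ p : {p : Fin n × Fin n // p.1 < p.2 ∧ H.Adj p.1 p.2}, 1 / (4 * (e : ℝ)) *
        (⟪u (p, true), v p.1.1 + v p.1.2⟫ + ⟪u (p, false), v p.1.1 - v p.1.2⟫) := by
  unfold stratBias
  simp_rw [graphGame_row_sum H e _ fun k => ⟪u _, v k⟫]
  rw [sum_graphRow]
  refine Finset.sum_congr rfl fun p _ => ?_
  simp only [inner_add_right, inner_sub_right]
  simp
  ring

lemma stratBias_le_quantumBias {ι κ : Type*} [Fintype ι] [Fintype κ] (G : Matrix ι κ ℝ) {N : ℕ}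
    (u : ι → EuclideanSpace ℝ (Fin N)) (v : κ → EuclideanSpace ℝ (Fin N))
    (hu : ∀ i, ‖u i‖ = 1) (hv : ∀ j, ‖v j‖ = 1) : stratBias G u v ≤ quantumBias G := by
  refine le_csSup ⟨∑ i, ∑ j, |G i j|, ?_⟩ ⟨N, u, v, hu, hv, rfl⟩
  rintro _ ⟨M, u', v', hu', hv', rfl⟩
  refine Finset.sum_le_sum fun i _ => Finset.sum_le_sum fun j _ => ?_
  have h := abs_real_inner_le_norm (u' i) (v' j)
  rw [hu', hv', one_mul] at h
  calc G i j * ⟪u' i, v' j⟫ ≤ |G i j * ⟪u' i, v' j⟫| := le_abs_self _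
    _ = |G i j| * |⟪u' i, v' j⟫| := abs_mul _ _
    _ ≤ |G i j| := mul_le_of_le_one_right (abs_nonneg _) h

/-- An orthonormal family of column vectors attains `2√2` on every edge. -/
lemma le_quantumBias_graphGame {n : ℕ} (H : SimpleGraph (Fin n)) [DecidableRel H.Adj] (e : ℕ) :
    ∑ _p : {p : Fin n × Fin n // p.1 < p.2 ∧ H.Adj p.1 p.2}, 1 / (4 * (e : ℝ)) * (2 * √2) ≤
      quantumBias (graphGame H e) := by
  let b : Fin n → EuclideanSpace ℝ (Fin n) := EuclideanSpace.basisFun (Fin n) ℝ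
  have hb : Orthonormal ℝ b := (EuclideanSpace.basisFun (Fin n) ℝ).orthonormal
  let u : GraphRow H → EuclideanSpace ℝ (Fin n) := fun r =>
    (√2)⁻¹ • (if r.2 then b r.1.1.1 + b r.1.1.2 else b r.1.1.1 - b r.1.1.2)
  have hs : √2 * √2 = 2 := Real.mul_self_sqrt zero_le_two
  have hs0 : √2 ≠ 0 := by positivity
  have hadd : ∀ i j, i ≠ j → ⟪b i + b j, b i + b j⟫ = 2 := fun i j hij => by
    rw [real_inner_add_add_self, hb.inner_eq_zero hij, real_inner_self_eq_norm_sq,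
      real_inner_self_eq_norm_sq, hb.norm_eq_one, hb.norm_eq_one]
    norm_num
  have hsub : ∀ i j, i ≠ j → ⟪b i - b j, b i - b j⟫ = 2 := fun i j hij => by
    rw [real_inner_sub_sub_self, hb.inner_eq_zero hij, real_inner_self_eq_norm_sq,
      real_inner_self_eq_norm_sq, hb.norm_eq_one, hb.norm_eq_one]
    norm_num
  have hnorm : ∀ x : EuclideanSpace ℝ (Fin n), ⟪x, x⟫ = 2 → ‖(√2)⁻¹ • x‖ = 1 := fun x hx => by
    rw [norm_smul, norm_eq_sqrt_real_inner x, hx, Real.norm_of_nonneg (by positivity),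
      inv_mul_cancel₀ hs0]
  have hu : ∀ r, ‖u r‖ = 1 := by
    intro r
    have hne := r.1.2.1.ne
    refine hnorm _ ?_
    split_ifs
    exacts [hadd _ _ hne, hsub _ _ hne]
  refine le_of_eq_of_le ?_ (stratBias_le_quantumBias (graphGame H e) u b hu hb.norm_eq_one)
  rw [stratBias_graphGame]
  refine Finset.sum_congr rfl fun p _ => ?_
  have hne := p.2.1.ne
  have h1 : u (p, true) = (√2)⁻¹ • (b p.1.1 + b p.1.2) := rfl
  have h2 : u (p, false) = (√2)⁻¹ • (b p.1.1 - b p.1.2) := rfl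
  rw [h1, h2, real_inner_smul_left, real_inner_smul_left, hadd _ _ hne, hsub _ _ hne]
  have hinv : (√2)⁻¹ * 2 = √2 := (inv_mul_eq_iff_eq_mul₀ hs0).2 hs.symm
  rw [hinv, two_mul]

lemma inner_add_inner_sub_le {E : Type*} [NormedAddCommGroup E] [InnerProductSpace ℝ E]
    {a b x y : E} (ha : ‖a‖ = 1) (hb : ‖b‖ = 1) (hx : ‖x‖ = 1) (hy : ‖y‖ = 1) :
    ⟪a, x + y⟫ + ⟪b, x - y⟫ ≤ 2 * √2 - √2 / 4 * ⟪x, y⟫ ^ 2 := by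
  have h1 := real_inner_le_norm a (x + y)
  have h2 := real_inner_le_norm b (x - y)
  have h3 := norm_add_sq_real x y
  have h4 := norm_sub_sq_real x y
  have h5 := abs_le.1 (abs_real_inner_le_norm x y)
  rw [ha, one_mul] at h1
  rw [hb, one_mul] at h2
  rw [hx, hy] at h3 h4 h5
  set t := ⟪x, y⟫
  set p := ‖x + y‖
  set q := ‖x - y‖
  have hs : √2 ^ 2 = 2 := Real.sq_sqrt zero_le_two
  have hs0 : 0 ≤ √2 := Real.sqrt_nonneg 2
  have ht : t ^ 2 ≤ 1 := by nlinarith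
  have hpq : p * q ≤ 2 - t ^ 2 := by
    refine abs_le_of_sq_le_sq' ?_ (by linarith) |>.2
    rw [mul_pow, h3, h4]
    nlinarith [sq_nonneg (t ^ 2)]
  have hsum : p + q ≤ √2 * (2 - t ^ 2 / 4) := by
    refine abs_le_of_sq_le_sq' ?_ (mul_nonneg hs0 (by linarith)) |>.2
    rw [mul_pow, hs]
    nlinarith [sq_nonneg (t ^ 2)]
  linarith

/-- The dimension of the span of unit vectors is at least their number minus the sum of the
squares of the off-diagonal entries of their Gram matrix. -/
lemma two_mul_card_sub_le_finrank_span {ι E : Type*} [Fintype ι] [NormedAddCommGroup E]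
    [InnerProductSpace ℝ E] (v : ι → E) (hv : ∀ j, ‖v j‖ = 1) :
    2 * (Fintype.card ι : ℝ) - ∑ i, ∑ j, ⟪v i, v j⟫ ^ 2 ≤
      Module.finrank ℝ (Submodule.span ℝ (Set.range v)) := by
  set S := Submodule.span ℝ (Set.range v)
  have : FiniteDimensional ℝ S := FiniteDimensional.span_of_finite ℝ (Set.finite_range v)
  let b := stdOrthonormalBasis ℝ S
  let w : ι → S := fun i => ⟨v i, Submodule.subset_span ⟨i, rfl⟩⟩
  have hw : ∀ i j, ∑ k, ⟪w i, b k⟫ * ⟪w j, b k⟫ = ⟪v i, v j⟫ := fun i j => by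
    refine Eq.trans (Finset.sum_congr rfl fun k _ => ?_) (b.sum_inner_mul_inner (w i) (w j))
    rw [real_inner_comm (w j)]
  have hdiag : ∑ k, ∑ i, ⟪w i, b k⟫ * ⟪w i, b k⟫ = Fintype.card ι := by
    rw [Finset.sum_comm]
    simp_rw [hw, real_inner_self_eq_norm_sq, hv]
    simp
  have hfrob : ∑ k, ∑ l, (∑ i, ⟪w i, b k⟫ * ⟪w i, b l⟫) ^ 2 = ∑ i, ∑ j, ⟪v i, v j⟫ ^ 2 := by
    simp_rw [← hw, sq, Finset.sum_mul_sum]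
    calc _ = ∑ k, ∑ i, ∑ j, ∑ l,
          ⟪w i, b k⟫ * ⟪w i, b l⟫ * (⟪w j, b k⟫ * ⟪w j, b l⟫) := by
          refine Finset.sum_congr rfl fun k _ => ?_
          rw [Finset.sum_comm]
          exact Finset.sum_congr rfl fun i _ => Finset.sum_comm
      _ = ∑ i, ∑ j, ∑ k, ∑ l,
          ⟪w i, b k⟫ * ⟪w i, b l⟫ * (⟪w j, b k⟫ * ⟪w j, b l⟫) := by
          rw [Finset.sum_comm]
          exact Finset.sum_congr rfl fun i _ => Finset.sum_comm
      _ = _ := by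
          refine Finset.sum_congr rfl fun i _ => Finset.sum_congr rfl fun j _ =>
            Finset.sum_congr rfl fun k _ => Finset.sum_congr rfl fun l _ => ?_
          ring
  have hle : ∑ k, (2 * (∑ i, ⟪w i, b k⟫ * ⟪w i, b k⟫) - 1) ≤
      ∑ k, ∑ l, (∑ i, ⟪w i, b k⟫ * ⟪w i, b l⟫) ^ 2 := by
    refine Finset.sum_le_sum fun k _ => ?_
    have h := Finset.single_le_sum (f := fun l => (∑ i, ⟪w i, b k⟫ * ⟪w i, b l⟫) ^ 2)
      (fun l _ => sq_nonneg _) (Finset.mem_univ k)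
    refine le_trans ?_ h
    nlinarith [sq_nonneg ((∑ i, ⟪w i, b k⟫ * ⟪w i, b k⟫) - 1)]
  rw [hfrob, Finset.sum_sub_distrib, ← Finset.mul_sum, hdiag] at hle
  simp only [Finset.sum_const, Finset.card_univ, Fintype.card_fin, nsmul_eq_mul, mul_one] at hle
  linarith

lemma sum_sum_eq_sum_diag_add_two_mul {n : ℕ} (f : Fin n → Fin n → ℝ)
    (hf : ∀ i j, f i j = f j i) :
    ∑ i, ∑ j, f i j = ∑ i, f i i + 2 * ∑ p : {p : Fin n × Fin n //
      p.1 < p.2 ∧ (⊤ : SimpleGraph (Fin n)).Adj p.1 p.2}, f p.1.1 p.1.2 := by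
  have hedge : ∑ p : {p : Fin n × Fin n //
      p.1 < p.2 ∧ (⊤ : SimpleGraph (Fin n)).Adj p.1 p.2}, f p.1.1 p.1.2 =
      ∑ i, ∑ j, if i < j then f i j else 0 := by
    rw [← Fintype.sum_prod_type' (fun i j => if i < j then f i j else 0), ← Finset.sum_filter]
    refine (Finset.sum_subtype _ (fun p => ?_) fun p : Fin n × Fin n => f p.1 p.2).symm
    simpa using fun h : p.1 < p.2 => h.ne
  have hswap : ∑ i, ∑ j, (if j < i then f i j else 0) =
      ∑ i, ∑ j, if i < j then f i j else 0 := by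
    rw [Finset.sum_comm]
    simp_rw [hf]
  have hdiag : ∑ i, f i i = ∑ i, ∑ j, if i = j then f i j else 0 := by simp
  rw [hedge, two_mul]
  nth_rw 1 [← hswap]
  rw [hdiag, ← Finset.sum_add_distrib, ← Finset.sum_add_distrib]
  refine Finset.sum_congr rfl fun i _ => ?_
  rw [← Finset.sum_add_distrib, ← Finset.sum_add_distrib]
  refine Finset.sum_congr rfl fun j _ => ?_
  rcases lt_trichotomy i j with h | h | h
  · simp [h, h.ne, h.not_gt]
  · simp [h]
  · simp [h, h.ne', h.not_gt]

/-- every `ε`-optimal vector strategy for `CHSH(n)` has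
`dim span{v_1,…,v_n} ≥ n − 8√2·n(n−1)·ε`. -/
theorem CHSH_near_optimal_rank_bound (n : ℕ) (hn : 2 ≤ n) (ε : ℝ) (hε : 0 < ε)
    (N : ℕ) (u : GraphRow (⊤ : SimpleGraph (Fin n)) → EuclideanSpace ℝ (Fin N))
    (v : Fin n → EuclideanSpace ℝ (Fin N))
    (hu : ∀ r, ‖u r‖ = 1) (hv : ∀ j, ‖v j‖ = 1)
    (hopt : quantumBias (CHSHgame n) - ε ≤ stratBias (CHSHgame n) u v) :
    (n : ℝ) - 8 * Real.sqrt 2 * n * (n - 1) * ε ≤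
      Module.finrank ℝ (Submodule.span ℝ (Set.range v)) := by
  have hn' : (2 : ℝ) ≤ n := by exact_mod_cast hn
  have he : ((n * (n - 1) / 2 : ℕ) : ℝ) = n * (n - 1) / 2 := by
    rw [Nat.cast_div (Nat.even_mul_pred_self n).two_dvd two_ne_zero, Nat.cast_mul,
      Nat.cast_pred (by omega)]
    norm_num
  have hlow := le_quantumBias_graphGame (⊤ : SimpleGraph (Fin n)) (n * (n - 1) / 2)
  have hup : stratBias (CHSHgame n) u v ≤
      ∑ p : {p : Fin n × Fin n // p.1 < p.2 ∧ (⊤ : SimpleGraph (Fin n)).Adj p.1 p.2},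
        1 / (4 * ((n * (n - 1) / 2 : ℕ) : ℝ)) * (2 * √2 - √2 / 4 * ⟪v p.1.1, v p.1.2⟫ ^ 2) := by
    unfold CHSHgame
    rw [stratBias_graphGame]
    exact Finset.sum_le_sum fun p _ => mul_le_mul_of_nonneg_left
      (inner_add_inner_sub_le (hu _) (hu _) (hv _) (hv _)) (by positivity)
  have hsplit := sum_sum_eq_sum_diag_add_two_mul (fun i j => ⟪v i, v j⟫ ^ 2)
    fun i j => by rw [real_inner_comm]
  have hrank := two_mul_card_sub_le_finrank_span v hv
  simp only [real_inner_self_eq_norm_sq, hv, one_pow, Finset.sum_const, Finset.card_univ,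
    Fintype.card_fin, nsmul_eq_mul, mul_one] at hsplit hrank
  rw [hsplit] at hrank
  rw [← Finset.mul_sum] at hlow hup
  rw [Finset.sum_sub_distrib, ← Finset.mul_sum _ _ (√2 / 4)] at hup
  rw [he] at hlow hup
  unfold CHSHgame at hopt hup
  set X := ∑ p : {p : Fin n × Fin n // p.1 < p.2 ∧ (⊤ : SimpleGraph (Fin n)).Adj p.1 p.2},
    ⟪v p.1.1, v p.1.2⟫ ^ 2
  have hX : 1 / (4 * ((n : ℝ) * (n - 1) / 2)) * (√2 / 4 * X) ≤ ε := by
    rw [mul_sub] at hup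
    linarith
  have hpos : 0 < 4 * ((n : ℝ) * (n - 1) / 2) := by nlinarith
  rw [one_div, inv_mul_le_iff₀ hpos] at hX
  have hs : √2 * √2 = 2 := Real.mul_self_sqrt zero_le_two
  have hX2 := mul_le_mul_of_nonneg_left hX (Real.sqrt_nonneg 2)
  have hX3 : √2 * (√2 / 4 * X) = X / 2 := by linear_combination X / 4 * hs
  rw [hX3] at hX2
  linarith
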